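/- arXiv:2201.11079 — 2 statements merged into one kernel-verified Lean document; each statement's English description precedes it below -/
import Mathlib

section
/- There exists a constant C > 0 such that for every integer n ≥ 3, ∑_{d ∣ n} 1/φ(d) ≤ C · (log log n)², where the sum ranges over all positive divisors d of n. -/
open Finset

/-- A prime power's reciprocal totient sum is bounded by the full geometric series. -/
lemma sum_inv_totient_prime_pow_le {p : ℕ} (hp : p.Prime) (k : ℕ) :
    ∑ d ∈ (p ^ k).divisors, (1 : ℝ) / (d.totient : ℝ) ≤ 1 + p / ((p : ℝ) - 1) ^ 2 := by
  have hp1 : (1 : ℝ) < p := by exact_mod_cast hp.one_lt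
  have hp0 : (0 : ℝ) < p - 1 := by linarith
  have hsum : ∀ m : ℕ, ∑ i ∈ range (m + 1), (1 : ℝ) / ((p ^ i).totient : ℝ) =
      1 + p / ((p : ℝ) - 1) ^ 2 * (1 - 1 / (p : ℝ) ^ m) := by
    intro m
    induction m with
    | zero => simp
    | succ m ih =>
      rw [sum_range_succ, ih, Nat.totient_prime_pow_succ hp]
      push_cast [Nat.cast_sub hp.one_le]
      field_simp
      ring
  rw [Nat.sum_divisors_prime_pow hp, hsum]
  have h1 : (0 : ℝ) ≤ 1 / (p : ℝ) ^ k := by positivity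
  have h2 : (0 : ℝ) ≤ p / ((p : ℝ) - 1) ^ 2 := by positivity
  nlinarith

lemma one_add_div_sub_one_sq_le_exp {x : ℝ} (hx : 2 ≤ x) :
    1 + x / (x - 1) ^ 2 ≤ Real.exp (1 / x + 8 * (1 / x ^ 2)) := by
  have h : x / (x - 1) ^ 2 ≤ 1 / x + 8 * (1 / x ^ 2) := by
    have h1 : 0 < x - 1 := by linarith
    have h2 : 1 / x + 8 * (1 / x ^ 2) = (x + 8) / x ^ 2 := by field_simp
    rw [h2, div_le_div_iff₀ (by positivity) (by positivity)]
    nlinarith [mul_nonneg (by linarith : 0 ≤ x - 2) (by linarith : 0 ≤ x)]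
  linarith [Real.add_one_le_exp (1 / x + 8 * (1 / x ^ 2))]

lemma sum_inv_totient_divisors_mul {a b : ℕ} (hab : a.Coprime b) :
    ∑ d ∈ (a * b).divisors, (1 : ℝ) / (d.totient : ℝ) =
      (∑ d ∈ a.divisors, (1 : ℝ) / (d.totient : ℝ)) *
        ∑ d ∈ b.divisors, (1 : ℝ) / (d.totient : ℝ) := by
  rw [Nat.divisors_mul, Finset.mul_def, sum_image hab.mul_injOn_divisors, sum_mul_sum,
    ← sum_product']
  refine sum_congr rfl fun x hx => ?_
  rw [mem_product] at hx
  have hc : x.1.Coprime x.2 :=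
    (hab.coprime_dvd_left (Nat.dvd_of_mem_divisors hx.1)).coprime_dvd_right
      (Nat.dvd_of_mem_divisors hx.2)
  rw [Nat.totient_mul hc, Nat.cast_mul, one_div_mul_one_div]

lemma sum_inv_totient_divisors_le_exp (n : ℕ) :
    ∑ d ∈ n.divisors, (1 : ℝ) / (d.totient : ℝ) ≤
      Real.exp (∑ p ∈ n.primeFactors, (1 / (p : ℝ) + 8 * (1 / (p : ℝ) ^ 2))) := by
  induction n using Nat.recOnPosPrimePosCoprime with
  | zero => simp
  | one => simp
  | prime_pow p k hp hk =>
    rw [Nat.primeFactors_prime_pow hk.ne' hp, sum_singleton]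
    exact (sum_inv_totient_prime_pow_le hp k).trans
      (one_add_div_sub_one_sq_le_exp (by exact_mod_cast hp.two_le))
  | coprime a b _ _ hab iha ihb =>
    rw [sum_inv_totient_divisors_mul hab, hab.primeFactors_mul,
      sum_union hab.disjoint_primeFactors, Real.exp_add]
    gcongr

lemma inv_mul_log_le_log_log_sub {x : ℝ} (hx : 1 < x) :
    1 / ((x + 1) * Real.log (x + 1)) ≤ Real.log (Real.log (x + 1)) - Real.log (Real.log x) := by
  have h0 : 0 < Real.log x := Real.log_pos hx
  have h1 : 0 < Real.log (x + 1) := Real.log_pos (by linarith)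
  have h2 : 1 / (x + 1) ≤ Real.log (x + 1) - Real.log x := by
    have := Real.one_sub_inv_le_log_of_pos (x := (x + 1) / x) (by positivity)
    rw [Real.log_div (by positivity) (by positivity)] at this
    convert this using 1
    field_simp
    ring
  have h3 := Real.one_sub_inv_le_log_of_pos (x := Real.log (x + 1) / Real.log x) (by positivity)
  rw [Real.log_div h1.ne' h0.ne'] at h3
  refine le_trans ?_ h3
  calc 1 / ((x + 1) * Real.log (x + 1)) = 1 / (x + 1) / Real.log (x + 1) := by field_simp
    _ ≤ (Real.log (x + 1) - Real.log x) / Real.log (x + 1) := by gcongr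
    _ = 1 - (Real.log (x + 1) / Real.log x)⁻¹ := by field_simp

/-- A weak upper bound of Mertens type, from Chebyshev's bound by partial summation. -/
lemma exists_sum_primesLE_inv_le :
    ∃ K : ℝ, ∀ N : ℕ, 2 ≤ N →
      ∑ p ∈ N.primesLE, 1 / (p : ℝ) ≤ Real.log 4 * Real.log (Real.log N) + K := by
  set c := Real.log 4
  have hc0 : 0 ≤ c := Real.log_nonneg (by norm_num)
  have hθ : ∀ N : ℕ, Chebyshev.theta N ≤ c * N := fun N =>
    Chebyshev.theta_le_log4_mul_x (Nat.cast_nonneg N)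
  obtain ⟨K, hK⟩ : ∃ K : ℝ, ∀ N : ℕ, 2 ≤ N → ∑ p ∈ N.primesLE, 1 / (p : ℝ) ≤
      c * Real.log (Real.log N) +
        (Chebyshev.theta N - c * N) * (1 / ((N : ℝ) * Real.log N)) + K := by
    refine ⟨∑ p ∈ Nat.primesLE 2, 1 / (p : ℝ) - (c * Real.log (Real.log (2 : ℕ)) +
        (Chebyshev.theta (2 : ℕ) - c * (2 : ℕ)) * (1 / (((2 : ℕ) : ℝ) * Real.log (2 : ℕ)))),
      fun N hN => ?_⟩
    induction N, hN using Nat.le_induction with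
    | base => linarith
    | succ N hN ih =>
      have hN1 : (1 : ℝ) < N := by exact_mod_cast hN
      have hlog : 0 < Real.log N := Real.log_pos hN1
      have hlog' : 0 < Real.log ((N : ℝ) + 1) := Real.log_pos (by linarith)
      have hstep : ∑ p ∈ (N + 1).primesLE, 1 / (p : ℝ) = ∑ p ∈ N.primesLE, 1 / (p : ℝ) +
          (Chebyshev.theta (N + 1 : ℕ) - Chebyshev.theta N) *
            (1 / (((N : ℝ) + 1) * Real.log ((N : ℝ) + 1))) := by
        rw [Chebyshev.theta_eq_sum_primesLE_log, Chebyshev.theta_eq_sum_primesLE_log,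
          Nat.primesLE_succ]
        split_ifs with h
        · rw [sum_insert (Nat.notMem_primesLE N), sum_insert (Nat.notMem_primesLE N)]
          push_cast
          field_simp
          ring
        · simp
      have hanti : 1 / (((N : ℝ) + 1) * Real.log ((N : ℝ) + 1)) ≤ 1 / ((N : ℝ) * Real.log N) := by
        gcongr <;> linarith
      have hLL := mul_le_mul_of_nonneg_left (inv_mul_log_le_log_log_sub hN1) hc0
      have hprod := mul_nonneg (sub_nonneg.2 (hθ N)) (sub_nonneg.2 hanti)
      rw [hstep]
      push_cast
      push_cast at ih
      linarith
  refine ⟨K, fun N hN => (hK N hN).trans ?_⟩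
  have hN1 : (1 : ℝ) < N := by exact_mod_cast hN
  have hlog : 0 < Real.log N := Real.log_pos hN1
  have h1 : (0 : ℝ) ≤ 1 / ((N : ℝ) * Real.log N) := by positivity
  nlinarith [mul_nonneg (sub_nonneg.2 (hθ N)) h1]

lemma card_primeFactors_mul_log_two_le {n : ℕ} (hn : n ≠ 0) :
    (n.primeFactors.card : ℝ) * Real.log 2 ≤ Real.log n := by
  have h : 2 ^ n.primeFactors.card ≤ n :=
    (pow_card_le_prod n.primeFactors (fun p => p) 2
      fun p hp => (Nat.prime_of_mem_primeFactors hp).two_le).trans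
      (Nat.le_of_dvd (Nat.pos_of_ne_zero hn) (Nat.prod_primeFactors_dvd n))
  rw [← Real.log_pow]
  exact Real.log_le_log (by positivity) (by exact_mod_cast h)

lemma sum_primeFactors_inv_le {n : ℕ} (hn : 1 < n) :
    ∑ p ∈ n.primeFactors, 1 / (p : ℝ) ≤
      ∑ p ∈ (⌊Real.log n⌋₊).primesLE, 1 / (p : ℝ) + 1 / Real.log 2 := by
  have hlog : 0 < Real.log n := Real.log_pos (by exact_mod_cast hn)
  have hlog2 : 0 < Real.log 2 := Real.log_pos (by norm_num)
  rw [← sum_filter_add_sum_filter_not n.primeFactors (fun p => p ≤ ⌊Real.log n⌋₊)]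
  gcongr ?_ + ?_
  · refine sum_le_sum_of_subset_of_nonneg (fun p hp => ?_) fun _ _ _ => by positivity
    rw [mem_filter] at hp
    exact Nat.mem_primesLE.2 ⟨hp.2, Nat.prime_of_mem_primeFactors hp.1⟩
  · have hterm : ∀ p ∈ n.primeFactors.filter (fun p => ¬ p ≤ ⌊Real.log n⌋₊),
        1 / (p : ℝ) ≤ 1 / Real.log n := by
      intro p hp
      rw [mem_filter, not_le] at hp
      have := (Nat.floor_lt hlog.le).1 hp.2
      gcongr
    refine (sum_le_card_nsmul _ _ _ hterm).trans ?_
    have hcard : ((n.primeFactors.filter (fun p => ¬ p ≤ ⌊Real.log n⌋₊)).card : ℝ) ≤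
        n.primeFactors.card := by exact_mod_cast card_filter_le _ _
    have := card_primeFactors_mul_log_two_le (n := n) (by omega)
    rw [nsmul_eq_mul, mul_one_div, div_le_div_iff₀ hlog hlog2]
    nlinarith

/-- There exists a constant `C > 0` such that for every integer `n ≥ 3`,
`∑_{d ∣ n} 1/φ(d) ≤ C · (log log n)²`, where the sum ranges over all positive
divisors `d` of `n`, `φ` is Euler's totient function and `log` is the natural
logarithm. -/
theorem sum_inv_totient_divisors_le :
    ∃ C : ℝ, 0 < C ∧ ∀ n : ℕ, 3 ≤ n →
      ∑ d ∈ n.divisors, (1 : ℝ) / (Nat.totient d : ℝ) ≤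
        C * Real.log (Real.log (n : ℝ)) ^ 2 := by
  obtain ⟨K, hK⟩ := exists_sum_primesLE_inv_le
  have hlog3 : 1 < Real.log 3 := by
    rw [Real.lt_log_iff_exp_lt (by norm_num)]
    exact Real.exp_one_lt_three
  have hLL3 : 0 < Real.log (Real.log 3) := Real.log_pos hlog3
  set M := K + 1 / Real.log 2 + 8 * ∑' m : ℕ, 1 / (m : ℝ) ^ 2
  refine ⟨Real.exp M + Real.exp 3 / Real.log (Real.log 3) ^ 2, by positivity, fun n hn => ?_⟩
  have hn3 : (3 : ℝ) ≤ n := by exact_mod_cast hn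
  have hlogn : Real.log 3 ≤ Real.log n := Real.log_le_log (by norm_num) hn3
  have hLLn : Real.log (Real.log 3) ≤ Real.log (Real.log n) :=
    Real.log_le_log (by linarith) hlogn
  rw [add_mul]
  rcases lt_or_ge (Real.log n) 3 with hsmall | hlarge
  · have hn_lt : (n : ℝ) < Real.exp 3 := (Real.log_lt_iff_lt_exp (by linarith)).1 hsmall
    have hsum : ∑ d ∈ n.divisors, (1 : ℝ) / (Nat.totient d : ℝ) ≤ n := by
      calc ∑ d ∈ n.divisors, (1 : ℝ) / (Nat.totient d : ℝ) ≤ ∑ d ∈ n.divisors, (1 : ℝ) := by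
            refine sum_le_sum fun d hd => ?_
            rw [div_le_one (by exact_mod_cast Nat.totient_pos.2 (Nat.pos_of_mem_divisors hd))]
            exact_mod_cast Nat.totient_pos.2 (Nat.pos_of_mem_divisors hd)
        _ ≤ n := by simpa using Nat.card_divisors_le_self n
    have hbound : Real.exp 3 ≤
        Real.exp 3 / Real.log (Real.log 3) ^ 2 * Real.log (Real.log n) ^ 2 := by
      rw [div_mul_eq_mul_div, le_div_iff₀ (by positivity)]
      gcongr
    have : 0 ≤ Real.exp M * Real.log (Real.log n) ^ 2 := by positivity
    linarith
  · set N := ⌊Real.log n⌋₊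
    have hN3 : 3 ≤ N := Nat.le_floor (by exact_mod_cast hlarge)
    have hN3' : (3 : ℝ) ≤ N := by exact_mod_cast hN3
    have hNle : (N : ℝ) ≤ Real.log n := Nat.floor_le (by linarith)
    have hlogN : 1 ≤ Real.log N := hlog3.le.trans (Real.log_le_log (by norm_num) hN3')
    have hLLN : 0 ≤ Real.log (Real.log N) := Real.log_nonneg hlogN
    have hlog4 : Real.log 4 ≤ 2 := by
      rw [show (4 : ℝ) = 2 ^ 2 by norm_num, Real.log_pow]
      have := Real.log_two_lt_d9
      push_cast
      linarith
    have hsq : ∑ p ∈ n.primeFactors, 1 / (p : ℝ) ^ 2 ≤ ∑' m : ℕ, 1 / (m : ℝ) ^ 2 :=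
      (Real.summable_one_div_nat_pow.2 one_lt_two).sum_le_tsum _ fun _ _ => by positivity
    have hexp : ∑ p ∈ n.primeFactors, (1 / (p : ℝ) + 8 * (1 / (p : ℝ) ^ 2)) ≤
        M + 2 * Real.log (Real.log N) := by
      rw [sum_add_distrib, ← mul_sum]
      have h1 := sum_primeFactors_inv_le (n := n) (by omega)
      have h2 := hK N (by omega)
      have h3 := mul_le_mul_of_nonneg_right hlog4 hLLN
      linarith
    have hexp_eq : Real.exp (M + 2 * Real.log (Real.log N)) = Real.exp M * Real.log N ^ 2 := by
      rw [Real.exp_add M, two_mul, Real.exp_add (Real.log _), Real.exp_log (by linarith), sq]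
    have hlogle : Real.log N ≤ Real.log (Real.log n) := Real.log_le_log (by linarith) hNle
    calc ∑ d ∈ n.divisors, (1 : ℝ) / (Nat.totient d : ℝ)
        ≤ Real.exp (M + 2 * Real.log (Real.log N)) :=
          (sum_inv_totient_divisors_le_exp n).trans (Real.exp_le_exp.2 hexp)
      _ = Real.exp M * Real.log N ^ 2 := hexp_eq
      _ ≤ Real.exp M * Real.log (Real.log n) ^ 2 := by gcongr
      _ ≤ _ := le_add_of_nonneg_right (by positivity)
end

section
/- Let p be an odd prime and let Δ < 0 be an integer with Δ ≡ 0 or 1 (mod 4). If there exist integers x, y, z with x² + p·y² + p·z² = −Δ and x ≡ z (mod 2), then there exists an element θ ∈ O₀ ⊂ ℍ[ℚ, −1, −p] with θ ∉ ℚ·1 such that (2θ − ε·1)² = Δ·1, where ε ∈ {0, 1} is determined by ε ≡ Δ (mod 2). (Consequently the quadratic order of discriminant Δ embeds into O₀ via θ.) -/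
open Quaternion

/-- The element `i` of the quaternion algebra `ℍ[ℚ, -1, -p]`
(basis `1, i, j, k` with `i² = -1`, `j² = -p`, `k = ij = -ji`). -/
def qi (p : ℕ) : ℍ[ℚ, -1, -(p : ℚ)] := ⟨0, 1, 0, 0⟩

/-- The element `j` of the quaternion algebra `ℍ[ℚ, -1, -p]`. -/
def qj (p : ℕ) : ℍ[ℚ, -1, -(p : ℚ)] := ⟨0, 0, 1, 0⟩

/-- The element `k` of the quaternion algebra `ℍ[ℚ, -1, -p]`. -/
def qk (p : ℕ) : ℍ[ℚ, -1, -(p : ℚ)] := ⟨0, 0, 0, 1⟩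

/-- `O₀`: the `ℤ`-submodule of `ℍ[ℚ, -1, -p]` spanned by
`1, i, (i+k)/2, (1+j)/2`. -/
def O₀ (p : ℕ) : Submodule ℤ (ℍ[ℚ, -1, -(p : ℚ)]) :=
  Submodule.span ℤ
    ({1, qi p, (2⁻¹ : ℚ) • (qi p + qk p), (2⁻¹ : ℚ) • (1 + qj p)} :
      Set (ℍ[ℚ, -1, -(p : ℚ)]))

/-- Let `p` be an odd prime and let `Δ < 0` be an integer with
`Δ ≡ 0` or `1 (mod 4)`.  If there exist integers `x, y, z` with
`x² + p·y² + p·z² = −Δ` and `x ≡ z (mod 2)`, then there exists an element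
`θ ∈ O₀ ⊂ ℍ[ℚ, −1, −p]` with `θ ∉ ℚ·1` such that `(2θ − ε·1)² = Δ·1`, where
`ε ∈ {0, 1}` is determined by `ε ≡ Δ (mod 2)`.  (Consequently the quadratic
order of discriminant `Δ` embeds into `O₀` via `θ`.) -/
theorem exists_embedding_of_norm_form_solution
    (p : ℕ) (hp : p.Prime) (hodd : Odd p)
    (Δ : ℤ) (hΔneg : Δ < 0) (hΔ : Δ % 4 = 0 ∨ Δ % 4 = 1)
    (hsol : ∃ x y z : ℤ,
      x ^ 2 + (p : ℤ) * y ^ 2 + (p : ℤ) * z ^ 2 = -Δ ∧ x % 2 = z % 2) :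
    ∃ θ : ℍ[ℚ, -1, -(p : ℚ)], θ ∈ O₀ p ∧
      (¬ ∃ q : ℚ, θ = q • (1 : ℍ[ℚ, -1, -(p : ℚ)])) ∧
      ∃ ε : ℤ, (ε = 0 ∨ ε = 1) ∧ (2 : ℤ) ∣ (Δ - ε) ∧
        ((2 : ℚ) • θ - (ε : ℚ) • (1 : ℍ[ℚ, -1, -(p : ℚ)])) ^ 2 =
          (Δ : ℚ) • (1 : ℍ[ℚ, -1, -(p : ℚ)]) := by
  obtain ⟨x, y, z, hxyz, hpar⟩ := hsol
  obtain ⟨b, hb⟩ : (2 : ℤ) ∣ x - z := by lia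
  have hparity : (2 : ℤ) ∣ Δ % 2 - y := by
    obtain ⟨n, rfl⟩ := hodd
    obtain ⟨u, hu⟩ := Int.even_mul_succ_self x
    obtain ⟨v, hv⟩ := Int.even_mul_succ_self y
    obtain ⟨w, hw⟩ := Int.even_mul_succ_self z
    have hΔy : Δ - y = 2 * (x - b - u - v - w - n * (y ^ 2 + z ^ 2)) := by
      push_cast at hxyz
      linear_combination hxyz - hu - hv - hw - hb
    lia
  obtain ⟨a, ha⟩ := hparity
  have hx : (x : ℚ) = z + 2 * b := by
    have : x = z + 2 * b := by lia
    exact_mod_cast this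
  have hε : ((Δ % 2 : ℤ) : ℚ) = y + 2 * a := by
    have : Δ % 2 = y + 2 * a := by lia
    exact_mod_cast this
  have hnorm : (x : ℚ) ^ 2 + p * y ^ 2 + p * z ^ 2 = -Δ := by exact_mod_cast hxyz
  refine ⟨⟨(Δ % 2 : ℤ) / 2, x / 2, y / 2, z / 2⟩, ?_, ?_, Δ % 2, by lia, by lia, ?_⟩
  · simp only [O₀, Submodule.mem_span_insert, Submodule.mem_span_singleton]
    refine ⟨a, _, ⟨b, _, ⟨z, _, ⟨y, rfl⟩, rfl⟩, rfl⟩, ?_⟩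
    ext <;> simp [qi, qj, qk, hx, hε] <;> ring
  · rintro ⟨q, hq⟩
    have hi := congrArg QuaternionAlgebra.imI hq
    have hj := congrArg QuaternionAlgebra.imJ hq
    have hk := congrArg QuaternionAlgebra.imK hq
    simp at hi hj hk
    subst hi hj hk
    simp at hxyz
    lia
  · rw [sq]
    ext <;> simp
    · linear_combination -hnorm
    all_goals ring
end
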